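/- arXiv:1706.05444 — 2 statements merged into one kernel-verified Lean document; each statement's English description precedes it below -/
import Mathlib

section
/- Suppose A is a near-modular set with respect to 3^ℓ for some ℓ ≥ 1 with |A| = 2^ℓ, and (b_k)_{k≥0} is a sequence of positive integers such that 3^{k+ℓ} is the largest power of three dividing b_k for every k. Let n_0 be an index such that b_n = 3^{n+ℓ} for all n ≥ n_0 and b_{n_0} > max(A) + Σ_{k=0}^{n_0−1} b_k. Then every element of L = { a + Σ_{k=0}^{n_0−1} δ_k·b_k : a ∈ A, δ_k ∈ {0,1} } has a unique such representation: if a + Σ_{k=0}^{n_0−1} δ_k·b_k = a' + Σ_{k=0}^{n_0−1} δ'_k·b_k with a, a' ∈ A and δ_k, δ'_k ∈ {0,1}, then a = a' and δ_k = δ'_k for all k. -/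
/-- The next term of a Stanley sequence: the least integer greater than all current
elements such that the extended set remains free of nontrivial 3-term APs. -/
noncomputable def stanleyNext (S : Finset ℕ) : ℕ :=
  sInf {x : ℕ | (∀ s ∈ S, s < x) ∧ ThreeAPFree (insert x (S : Set ℕ))}

/-- Iteratively extend the initial set `A` greedily. -/
noncomputable def stanleyIter (A : Finset ℕ) : ℕ → Finset ℕ
  | 0 => A
  | n + 1 => insert (stanleyNext (stanleyIter A n)) (stanleyIter A n)

/-- The set of terms of the Stanley sequence `S(A)`. -/
noncomputable def stanleySet (A : Finset ℕ) : Set ℕ :=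
  ⋃ n, (stanleyIter A n : Set ℕ)

/-- The Stanley sequence `S(A)` as a sequence, listed in increasing order. -/
noncomputable def stanleySeq (A : Finset ℕ) (n : ℕ) : ℕ :=
  Nat.nth (· ∈ stanleySet A) n

/-- A sequence is independent with character `lam` if there is `χ` such that for all
`k ≥ χ` and `0 ≤ i < 2^k`, `a (2^k + i) = a (2^k) + a i` and `a (2^k) = 2*a (2^k - 1) - lam + 1`. -/
def IsIndependent (a : ℕ → ℕ) (lam : ℕ) : Prop :=
  ∃ χ : ℕ, ∀ k ≥ χ, (∀ i < 2 ^ k, a (2 ^ k + i) = a (2 ^ k) + a i) ∧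
    a (2 ^ k) + lam = 2 * a (2 ^ k - 1) + 1

/-- `lam` is achieved as the character of an independent Stanley sequence. -/
def IsCharacter (lam : ℕ) : Prop :=
  ∃ A : Finset ℕ, 0 ∈ A ∧ ThreeAPFree (A : Set ℕ) ∧
    IsIndependent (stanleySeq A) lam

/-- A set `A` of nonnegative integers is near-modular with respect to `N`. -/
def NearModular (A : Set ℕ) (N : ℕ) : Prop :=
  0 ∈ A ∧
  (∀ x ∈ A, ∀ y ∈ A, ∀ z ∈ A,
    (x : ℤ) ≡ 2 * (y : ℤ) - (z : ℤ) [ZMOD (N : ℤ)] → x = y ∧ y = z) ∧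
  (∀ x : ℤ, ∃ y ∈ A, ∃ z ∈ A, z ≤ y ∧ x ≡ 2 * (y : ℤ) - (z : ℤ) [ZMOD (N : ℤ)])

/-- A modular set mod `N`: a near-modular set contained in `{0, …, N-1}`. -/
def IsModularSet (A : Finset ℕ) (N : ℕ) : Prop :=
  (∀ a ∈ A, a < N) ∧ NearModular (A : Set ℕ) N

/-- The Stanley sequence with term set `stanleySet A` is basic with basis `b`. -/
def IsBasicSequence (A : Finset ℕ) (b : ℕ → ℕ) : Prop :=
  (∃ α K : ℕ, ∀ k ≥ K, b k = α * 3 ^ k) ∧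
  stanleySet A = {x : ℕ | ∃ F : Finset ℕ, x = ∑ k ∈ F, b k}

/-- If the `p`-adic valuation of `b k` is exactly `k + m`, then a vanishing combination of the
`b k` whose coefficients are zero or a unit has only zero coefficients. -/
theorem eq_zero_of_sum_mul_eq_zero_of_pow_dvd {p : ℤ} {m n : ℕ} {b c : ℕ → ℤ}
    (hb : ∀ k, p ^ (k + m) ∣ b k) (hb' : ∀ k, ¬ p ^ (k + m + 1) ∣ b k)
    (hc : ∀ k, c k = 0 ∨ IsUnit (c k))
    (h : ∑ k ∈ Finset.range n, c k * b k = 0) : ∀ k < n, c k = 0 := by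
  intro k
  induction k using Nat.strong_induction_on with
  | _ k ih =>
    intro hk
    refine (hc k).resolve_right fun hu => hb' k ?_
    rw [← Finset.add_sum_erase _ _ (Finset.mem_range.2 hk)] at h
    rw [← hu.dvd_mul_left, eq_neg_of_add_eq_zero_left h, dvd_neg]
    refine Finset.dvd_sum fun j hj => ?_
    obtain ⟨hjk, hjn⟩ := Finset.mem_erase.1 hj
    rcases lt_or_gt_of_ne hjk with hlt | hgt
    · simp [ih j hlt (Finset.mem_range.1 hjn)]
    · exact ((pow_dvd_pow p (by omega)).trans (hb j)).mul_left _

/-- Elements of a near-modular set lie in distinct residue classes. -/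
theorem NearModular.eq_of_modEq {A : Set ℕ} {N x y : ℕ} (hA : NearModular A N)
    (hx : x ∈ A) (hy : y ∈ A) (h : (x : ℤ) ≡ y [ZMOD N]) : x = y :=
  (hA.2.1 x hx y hy y hy (by rwa [two_mul, add_sub_cancel_right])).1

/-- In the setting of the previous lemma, every element of `L` has a unique
representation `a + Σ_{k<n₀} δ k * b k`. -/
theorem L_unique_representation (ℓ : ℕ) (hℓ : 1 ≤ ℓ) (A : Finset ℕ) (hA0 : A.Nonempty)
    (hA : NearModular (A : Set ℕ) (3 ^ ℓ)) (hcard : A.card = 2 ^ ℓ)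
    (b : ℕ → ℕ) (hpos : ∀ k, 0 < b k)
    (hdvd : ∀ k, 3 ^ (k + ℓ) ∣ b k ∧ ¬ 3 ^ (k + ℓ + 1) ∣ b k)
    (n0 : ℕ) (hn0 : ∀ n ≥ n0, b n = 3 ^ (n + ℓ))
    (hbig : A.max' hA0 + ∑ k ∈ Finset.range n0, b k < b n0)
    (a a' : ℕ) (ha : a ∈ A) (ha' : a' ∈ A)
    (δ δ' : ℕ → ℕ) (hδ : ∀ k, δ k ≤ 1) (hδ' : ∀ k, δ' k ≤ 1)
    (heq : a + ∑ k ∈ Finset.range n0, δ k * b k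
         = a' + ∑ k ∈ Finset.range n0, δ' k * b k) :
    a = a' ∧ ∀ k < n0, δ k = δ' k := by
  have hdvd_sum : ∀ ε : ℕ → ℕ, 3 ^ ℓ ∣ ∑ k ∈ Finset.range n0, ε k * b k := fun ε =>
    Finset.dvd_sum fun k _ => ((pow_dvd_pow 3 (Nat.le_add_left ℓ k)).trans (hdvd k).1).mul_left _
  have hmod : a ≡ a' [MOD 3 ^ ℓ] :=
    Nat.ModEq.add_right_cancel
      (((Nat.modEq_zero_iff_dvd.2 (hdvd_sum δ)).trans
        (Nat.modEq_zero_iff_dvd.2 (hdvd_sum δ')).symm))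
      (by rw [heq])
  have haa : a = a' := hA.eq_of_modEq ha ha' (Int.natCast_modEq_iff.2 hmod)
  subst haa
  refine ⟨rfl, fun k hk => ?_⟩
  have hsum : ∑ k ∈ Finset.range n0, ((δ k : ℤ) - δ' k) * (b k : ℤ) = 0 := by
    simp only [sub_mul, Finset.sum_sub_distrib]
    exact sub_eq_zero.2 (mod_cast Nat.add_left_cancel heq)
  have hzero := eq_zero_of_sum_mul_eq_zero_of_pow_dvd (p := 3) (m := ℓ)
    (fun k => mod_cast (hdvd k).1) (fun k => mod_cast (hdvd k).2)
    (fun k => by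
      have h₁ := hδ k
      have h₂ := hδ' k
      rw [Int.isUnit_iff]
      omega) hsum k hk
  omega
end

section
/- For every nonnegative integer j, the sets A_3^j = {0, 2, 3, 5, 11, 14, 18, 21, 29, 30, 32, 38, 41, 45, 48, 54 + 81j} and B_3^j = {0, 4, 6, 10, 22, 28, 36, 42, 58, 60, 64, 76, 82, 90, 96, 108 + 81j} are near-modular with respect to 81. -/
/-- Near-modularity of a finite set is a finite check on residues. -/
theorem nearModular_coe_finset {S : Finset ℕ} {N : ℕ} (hN : 0 < N) (h0 : 0 ∈ S)
    (hfree : ∀ x ∈ S, ∀ y ∈ S, ∀ z ∈ S, (x + z) % N = 2 * y % N → x = y ∧ y = z)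
    (hcover : ∀ r < N, ∃ y ∈ S, ∃ z ∈ S, z ≤ y ∧ (r + z) % N = 2 * y % N) :
    NearModular (S : Set ℕ) N := by
  refine ⟨h0, fun x hx y hy z hz h => hfree x hx y hy z hz ?_, fun x => ?_⟩
  · have h' := h.add_right (z : ℤ)
    rw [sub_add_cancel] at h'
    exact (Int.natCast_modEq_iff (n := N)).mp (by exact_mod_cast h')
  · have hN' : (0 : ℤ) < N := by exact_mod_cast hN
    obtain ⟨r, hr⟩ := Int.eq_ofNat_of_zero_le (Int.emod_nonneg x hN'.ne')
    have hrN : r < N := by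
      have := Int.emod_lt_of_pos x hN'
      omega
    obtain ⟨y, hy, z, hz, hzy, h⟩ := hcover r hrN
    refine ⟨y, hy, z, hz, hzy, ?_⟩
    have h' : ((r + z : ℕ) : ℤ) ≡ ((2 * y : ℕ) : ℤ) [ZMOD N] := Int.natCast_modEq_iff.mpr h
    have hx : x ≡ r [ZMOD N] := hr ▸ (Int.mod_modEq x N).symm
    push_cast at h'
    simpa using hx.trans (by simpa using h'.sub_right (z : ℤ))

/-- Near-modularity is preserved when the maximum is increased by a multiple of the modulus. -/
theorem NearModular.insert_add_mul {S : Set ℕ} {m N : ℕ} (h : NearModular (insert m S) N)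
    (h0 : 0 ∈ S) (hm : ∀ s ∈ S, s < m) (j : ℕ) :
    NearModular (insert (m + N * j) S) N := by
  obtain ⟨-, hfree, hcover⟩ := h
  let f : ℕ → ℕ := fun x => if x = m then m + N * j else x
  have hfm : f m = m + N * j := if_pos rfl
  have hfS : ∀ s ∈ S, f s = s := fun s hs => if_neg (hm s hs).ne
  have hfmod : ∀ x, (f x : ℤ) ≡ x [ZMOD N] := by
    intro x
    by_cases hx : x = m
    · subst hx
      rw [hfm]
      push_cast
      simp [Int.ModEq]
    · simp [f, hx, Int.ModEq.refl]
  have hfmem : ∀ x ∈ insert m S, f x ∈ insert (m + N * j) S := by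
    rintro x (rfl | hx)
    · exact Or.inl hfm
    · exact Or.inr ((hfS x hx).symm ▸ hx)
  have hfsurj : ∀ x ∈ insert (m + N * j) S, ∃ t ∈ insert m S, f t = x := by
    rintro x (rfl | hx)
    · exact ⟨m, Or.inl rfl, hfm⟩
    · exact ⟨x, Or.inr hx, hfS x hx⟩
  refine ⟨Or.inr h0, fun x hx y hy z hz hxyz => ?_, fun x => ?_⟩
  · obtain ⟨x, hx', rfl⟩ := hfsurj x hx
    obtain ⟨y, hy', rfl⟩ := hfsurj y hy
    obtain ⟨z, hz', rfl⟩ := hfsurj z hz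
    obtain ⟨rfl, rfl⟩ := hfree x hx' y hy' z hz'
      (((hfmod x).symm.trans hxyz).trans (((hfmod y).mul_left 2).sub (hfmod z)))
    exact ⟨rfl, rfl⟩
  · obtain ⟨y, hy, z, hz, hzy, hx⟩ := hcover x
    refine ⟨f y, hfmem y hy, f z, hfmem z hz, ?_,
      hx.trans (((hfmod y).mul_left 2).sub (hfmod z)).symm⟩
    rcases hy with rfl | hy
    · rcases hz with rfl | hz
      · exact le_rfl
      · rw [hfm, hfS z hz]
        exact hzy.trans (Nat.le_add_right _ _)
    · rcases hz with rfl | hz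
      · exact absurd (hm y hy) hzy.not_gt
      · rwa [hfS y hy, hfS z hz]

/-- A decidable criterion for near-modularity of a finite set together with an element that is
determined only up to a multiple of the modulus. -/
theorem nearModular_insert_add_mul {S : Finset ℕ} {m N : ℕ} (hN : 0 < N) (h0 : 0 ∈ S)
    (hm : ∀ s ∈ S, s < m)
    (hfree : ∀ x ∈ insert m S, ∀ y ∈ insert m S, ∀ z ∈ insert m S,
      (x + z) % N = 2 * y % N → x = y ∧ y = z)
    (hcover : ∀ r < N, ∃ y ∈ insert m S, ∃ z ∈ insert m S, z ≤ y ∧ (r + z) % N = 2 * y % N)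
    (j : ℕ) : NearModular (insert (m + N * j) (S : Set ℕ)) N := by
  refine NearModular.insert_add_mul ?_ (by exact_mod_cast h0) (by exact_mod_cast hm) j
  rw [← Finset.coe_insert]
  exact nearModular_coe_finset hN (Finset.mem_insert_of_mem h0) hfree hcover

/-- `A₃ʲ` and `B₃ʲ` are near-modular with respect to `81`. -/
theorem A3_B3_nearModular (j : ℕ) :
    NearModular ({0, 2, 3, 5, 11, 14, 18, 21, 29, 30, 32, 38, 41, 45, 48,
      54 + 81 * j} : Set ℕ) 81 ∧
    NearModular ({0, 4, 6, 10, 22, 28, 36, 42, 58, 60, 64, 76, 82, 90, 96,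
      108 + 81 * j} : Set ℕ) 81 := by
  constructor
  · convert nearModular_insert_add_mul
      (S := {0, 2, 3, 5, 11, 14, 18, 21, 29, 30, 32, 38, 41, 45, 48})
      (m := 54) (N := 81) (by decide) (by decide) (by decide) (by decide +kernel)
      (by decide +kernel) j using 1
    ext x
    simp only [Finset.coe_insert, Finset.coe_singleton, Set.mem_insert_iff,
      Set.mem_singleton_iff]
    tauto
  · convert nearModular_insert_add_mul
      (S := {0, 4, 6, 10, 22, 28, 36, 42, 58, 60, 64, 76, 82, 90, 96})
      (m := 108) (N := 81) (by decide) (by decide) (by decide) (by decide +kernel)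
      (by decide +kernel) j using 1
    ext x
    simp only [Finset.coe_insert, Finset.coe_singleton, Set.mem_insert_iff,
      Set.mem_singleton_iff]
    tauto
end
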